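/- Cost monotonicity of pfold (Lemma 4 / cost_pfold_rec): for all complexity expressions r, s, t and every environment ξ*, cost(⟦s⟧ξ*) ≤ cost(⟦pfold r of (s,[p,ps,w]t)⟧ξ*). -/

import Mathlib

/-! Formalization of Lemma 4 (cost_pfold_rec) of "A static cost analysis for
a higher-order language" (Danner–Paykin–Royer). -/

/-! ### Complexity language: syntax, variables, substitution -/

/-- Complexity-language expressions: variables, numerals, addition, binary max,
pairs, cost/potential projections, abstraction `λ⋆x.r`, application `r ⋆ s`,
`pcase`, and `pfold`. -/
inductive CExp where
  | var (x : String)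
  | lit (n : ℕ)
  | add (r s : CExp)
  | cmax (r s : CExp)
  | pair (r s : CExp)
  | projc (r : CExp)
  | projp (r : CExp)
  | lam (x : String) (r : CExp)
  | app (r s : CExp)
  | pcase (r s : CExp) (p ps : String) (t : CExp)
  | pfold (r s : CExp) (p ps w : String) (t : CExp)

/-- Free variables of a complexity expression. -/
def CExp.fv : CExp → List String
  | .var x => [x]
  | .lit _ => []
  | .add r s => r.fv ++ s.fv
  | .cmax r s => r.fv ++ s.fv
  | .pair r s => r.fv ++ s.fv
  | .projc r => r.fv
  | .projp r => r.fv
  | .lam x r => r.fv.removeAll [x]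
  | .app r s => r.fv ++ s.fv
  | .pcase r s p ps t => r.fv ++ s.fv ++ t.fv.removeAll [p, ps]
  | .pfold r s p ps w t => r.fv ++ s.fv ++ t.fv.removeAll [p, ps, w]

/-- All variables (free and bound) of a complexity expression. -/
def CExp.vars : CExp → List String
  | .var x => [x]
  | .lit _ => []
  | .add r s => r.vars ++ s.vars
  | .cmax r s => r.vars ++ s.vars
  | .pair r s => r.vars ++ s.vars
  | .projc r => r.vars
  | .projp r => r.vars
  | .lam x r => x :: r.vars
  | .app r s => r.vars ++ s.vars
  | .pcase r s p ps t => p :: ps :: (r.vars ++ s.vars ++ t.vars)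
  | .pfold r s p ps w t => p :: ps :: w :: (r.vars ++ s.vars ++ t.vars)

/-- Substitution `e[x ↦ (a, y)]` of the pair expression `(a, y)` (a numeral
paired with a variable) for the variable `x` in `e`. -/
def CExp.substPV : CExp → String → ℕ → String → CExp
  | .var z, x, a, y => if z = x then .pair (.lit a) (.var y) else .var z
  | .lit n, _, _, _ => .lit n
  | .add r s, x, a, y => .add (r.substPV x a y) (s.substPV x a y)
  | .cmax r s, x, a, y => .cmax (r.substPV x a y) (s.substPV x a y)
  | .pair r s, x, a, y => .pair (r.substPV x a y) (s.substPV x a y)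
  | .projc r, x, a, y => .projc (r.substPV x a y)
  | .projp r, x, a, y => .projp (r.substPV x a y)
  | .lam z r, x, a, y => .lam z (if z = x then r else r.substPV x a y)
  | .app r s, x, a, y => .app (r.substPV x a y) (s.substPV x a y)
  | .pcase r s p ps t, x, a, y =>
      .pcase (r.substPV x a y) (s.substPV x a y) p ps
        (if p = x ∨ ps = x then t else t.substPV x a y)
  | .pfold r s p ps w t, x, a, y =>
      .pfold (r.substPV x a y) (s.substPV x a y) p ps w
        (if p = x ∨ ps = x ∨ w = x then t else t.substPV x a y)
/-! ### Complexity language: full complexity types, denotations, semantics -/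

/-- Full complexity types: simple types with products over ℕ.
Complexity types are those of the form `ℕ × γ` with `γ` a potential type;
potential types are `ℕ` and `γ → τ` with `γ` potential and `τ` complexity. -/
inductive FTy where
  | nat : FTy
  | prod : FTy → FTy → FTy
  | arrow : FTy → FTy → FTy
deriving DecidableEq

/-- Standard denotation of full complexity types (ℕ is the natural numbers). -/
def FTy.den : FTy → Type
  | .nat => ℕ
  | .prod a b => a.den × b.den
  | .arrow a b => a.den → b.den

/-- The (componentwise / pointwise) maximum on the denotation of each type. -/
def FTy.max : (τ : FTy) → τ.den → τ.den → τ.den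
  | .nat, a, b => Nat.max a b
  | .prod τ₁ τ₂, a, b =>
      (FTy.max τ₁ (Prod.fst a) (Prod.fst b), FTy.max τ₂ (Prod.snd a) (Prod.snd b))
  | .arrow _ τ₂, f, g => fun z => FTy.max τ₂ (f z) (g z)

/-- Semantic values of the complexity language: an element of the denotation of
some full complexity type. -/
def CVal : Type := (τ : FTy) × τ.den

/-- Complexity-language (semantic) environments. -/
def CEnv : Type := String → CVal

/-- Environment update `ξ[x ↦ v]`. -/
def CEnv.update (ξ : CEnv) (x : String) (v : CVal) : CEnv :=
  fun y => if y = x then v else ξ y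

/-- The denotational semantics of complexity terms, presented as a big-step
relation: `CSem e ξ ⟨τ, d⟩` means `⟦e⟧ξ = d` (at type `τ`).  `dally(n,(c,p)) =
(n+c,p)` is inlined in the `app` rule, and in the `pfold` rule on a successor
`q+1` a fresh variable `y` is bound to `q` for the recursive value `rec`. -/
inductive CSem : CExp → CEnv → CVal → Prop where
  | var {x ξ} : CSem (.var x) ξ (ξ x)
  | lit {n ξ} : CSem (.lit n) ξ ⟨.nat, n⟩
  | add {r s ξ} {m n : ℕ} : CSem r ξ ⟨.nat, m⟩ → CSem s ξ ⟨.nat, n⟩ →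
      CSem (.add r s) ξ ⟨.nat, m + n⟩
  | cmax {r s ξ} {τ : FTy} {a b : τ.den} : CSem r ξ ⟨τ, a⟩ → CSem s ξ ⟨τ, b⟩ →
      CSem (.cmax r s) ξ ⟨τ, τ.max a b⟩
  | pair {r s ξ} {τ₁ τ₂ : FTy} {a : τ₁.den} {b : τ₂.den} :
      CSem r ξ ⟨τ₁, a⟩ → CSem s ξ ⟨τ₂, b⟩ →
      CSem (.pair r s) ξ ⟨.prod τ₁ τ₂, (a, b)⟩
  | projc {r ξ} {τ₁ τ₂ : FTy} {v : (FTy.prod τ₁ τ₂).den} :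
      CSem r ξ ⟨.prod τ₁ τ₂, v⟩ → CSem (.projc r) ξ ⟨τ₁, Prod.fst v⟩
  | projp {r ξ} {τ₁ τ₂ : FTy} {v : (FTy.prod τ₁ τ₂).den} :
      CSem r ξ ⟨.prod τ₁ τ₂, v⟩ → CSem (.projp r) ξ ⟨τ₂, Prod.snd v⟩
  | lam {x r ξ} {γ η : FTy} {f : γ.den → (FTy.prod FTy.nat η).den} :
      (∀ p : γ.den, CSem r (ξ.update x ⟨.prod .nat γ, ((1 : ℕ), p)⟩) ⟨.prod .nat η, f p⟩) →
      CSem (.lam x r) ξ ⟨.prod .nat (.arrow γ (.prod .nat η)), ((1 : ℕ), f)⟩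
  | app {r s ξ} {γ η : FTy} {c₁ c₂ : ℕ} {f : γ.den → (FTy.prod FTy.nat η).den} {p : γ.den} :
      CSem r ξ ⟨.prod .nat (.arrow γ (.prod .nat η)), (c₁, f)⟩ →
      CSem s ξ ⟨.prod .nat γ, (c₂, p)⟩ →
      CSem (.app r s) ξ ⟨.prod .nat η, (1 + c₁ + c₂ + (Prod.fst (f p) : ℕ), Prod.snd (f p))⟩
  | pcaseZero {r s p ps t ξ v} : CSem r ξ ⟨.nat, (0 : ℕ)⟩ → CSem s ξ v →
      CSem (.pcase r s p ps t) ξ v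
  | pcaseSucc {r s p ps t ξ} {q : ℕ} {τ : FTy} {a b : τ.den} :
      CSem r ξ ⟨.nat, q + 1⟩ → CSem s ξ ⟨τ, a⟩ →
      CSem t ((ξ.update p ⟨.nat, (1 : ℕ)⟩).update ps ⟨.nat, q⟩) ⟨τ, b⟩ →
      CSem (.pcase r s p ps t) ξ ⟨τ, τ.max a b⟩
  | pfoldZero {r s p ps w t ξ v} : CSem r ξ ⟨.nat, (0 : ℕ)⟩ → CSem s ξ v →
      CSem (.pfold r s p ps w t) ξ v
  | pfoldSucc {r s p ps w t ξ} {y : String} {q rc sc tc : ℕ} {γ : FTy} {rp sp tp : γ.den} :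
      y ∉ (CExp.pfold r s p ps w t).fv →
      CSem r ξ ⟨.nat, q + 1⟩ →
      CSem (.pfold (.var y) s p ps w t) (ξ.update y ⟨.nat, q⟩) ⟨.prod .nat γ, (rc, rp)⟩ →
      CSem s ξ ⟨.prod .nat γ, (sc, sp)⟩ →
      CSem t (((ξ.update p ⟨.nat, (1 : ℕ)⟩).update ps ⟨.nat, q⟩).update w
                ⟨.prod .nat γ, ((1 : ℕ), rp)⟩) ⟨.prod .nat γ, (tc, tp)⟩ →
      CSem (.pfold r s p ps w t) ξ ⟨.prod .nat γ, (2 + rc + tc, FTy.max γ sp tp)⟩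

/-- The logical relation between denotations of two (possibly different) types.
It is equality on `ℕ`, and distinct type constructors are never related. -/
def FTy.Rel : (τ τ' : FTy) → τ.den → τ'.den → Prop
  | .nat, .nat, a, b => a = b
  | .prod τ₁ τ₂, .prod τ₁' τ₂', a, b =>
      FTy.Rel τ₁ τ₁' (Prod.fst a) (Prod.fst b) ∧ FTy.Rel τ₂ τ₂' (Prod.snd a) (Prod.snd b)
  | .arrow τ₁ τ₂, .arrow τ₁' τ₂', f, g =>
      ∀ a b, FTy.Rel τ₁ τ₁' a b → FTy.Rel τ₂ τ₂' (f a) (g b)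
  | _, _, _, _ => False

/-- The logical relation on semantic values. -/
def CVal.Rel (v v' : CVal) : Prop := FTy.Rel v.1 v'.1 v.2 v'.2

theorem FTy.rel_self_iff (τ : FTy) (a b : τ.den) : FTy.Rel τ τ a b ↔ a = b := by
  induction τ with
  | nat => simp [FTy.Rel]
  | prod τ₁ τ₂ ih₁ ih₂ =>
    simp only [FTy.Rel, ih₁, ih₂]
    exact Prod.ext_iff.symm
  | arrow τ₁ τ₂ ih₁ ih₂ =>
    simp only [FTy.Rel, ih₁, ih₂]
    exact ⟨fun h => funext fun x => h x x rfl, by rintro rfl x _ rfl; rfl⟩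

theorem CVal.Rel.refl (v : CVal) : v.Rel v := (FTy.rel_self_iff v.1 v.2 v.2).2 rfl

theorem CVal.Rel.nat {m n : ℕ} (h : m = n) : CVal.Rel ⟨.nat, m⟩ ⟨.nat, n⟩ := h

theorem CVal.Rel.one_pair {γ γ' : FTy} {a : γ.den} {a' : γ'.den} (h : FTy.Rel γ γ' a a') :
    CVal.Rel ⟨.prod .nat γ, ((1 : ℕ), a)⟩ ⟨.prod .nat γ', ((1 : ℕ), a')⟩ := ⟨rfl, h⟩

theorem FTy.Rel.max {τ τ' : FTy} {a b : τ.den} {a' b' : τ'.den}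
    (ha : FTy.Rel τ τ' a a') (hb : FTy.Rel τ τ' b b') :
    FTy.Rel τ τ' (τ.max a b) (τ'.max a' b') := by
  induction τ generalizing τ' with
  | nat =>
    cases τ' with
    | nat => exact congrArg₂ Nat.max ha hb
    | prod => exact ha.elim
    | arrow => exact ha.elim
  | prod τ₁ τ₂ ih₁ ih₂ =>
    cases τ' with
    | nat => exact ha.elim
    | prod => exact ⟨ih₁ ha.1 hb.1, ih₂ ha.2 hb.2⟩
    | arrow => exact ha.elim
  | arrow τ₁ τ₂ ih₁ ih₂ =>
    cases τ' with
    | nat => exact ha.elim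
    | prod => exact ha.elim
    | arrow => exact fun x y hxy => ih₂ (ha x y hxy) (hb x y hxy)

/-- Two environments are related on a list of variables. -/
def CEnv.RelOn (l : List String) (ξ ξ' : CEnv) : Prop := ∀ x ∈ l, (ξ x).Rel (ξ' x)

theorem CEnv.RelOn.mono {l l' : List String} {ξ ξ' : CEnv} (h : CEnv.RelOn l ξ ξ')
    (hl : l' ⊆ l) : CEnv.RelOn l' ξ ξ' := fun x hx => h x (hl hx)

/-- Related updates of one variable preserve relatedness, and the variable need not
have been related before. -/
theorem CEnv.RelOn.update {l : List String} {ξ ξ' : CEnv} {x : String} {v v' : CVal}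
    (h : CEnv.RelOn (l.removeAll [x]) ξ ξ') (hv : v.Rel v') :
    CEnv.RelOn l (ξ.update x v) (ξ'.update x v') := by
  intro y hy
  by_cases hyx : y = x
  · simpa [CEnv.update, hyx] using hv
  · simpa [CEnv.update, hyx] using h y (by simp [List.removeAll, hy, hyx])

theorem CEnv.update_of_notMem {l : List String} {ξ : CEnv} {x y : String} {v : CVal}
    (hy : y ∉ l) (hx : x ∈ l) : ξ.update y v x = ξ x :=
  if_neg fun h : x = y => hy (h ▸ hx)

theorem CEnv.RelOn.update_fresh_right {l : List String} {ξ ξ' : CEnv} {y : String} {v : CVal}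
    (h : CEnv.RelOn l ξ ξ') (hy : y ∉ l) : CEnv.RelOn l ξ (ξ'.update y v) := fun x hx =>
  (CEnv.update_of_notMem hy hx).symm ▸ h x hx

theorem CEnv.RelOn.update_fresh {l : List String} {ξ ξ' : CEnv} {y y' : String} {v v' : CVal}
    (h : CEnv.RelOn l ξ ξ') (hy : y ∉ l) (hy' : y' ∉ l) :
    CEnv.RelOn l (ξ.update y v) (ξ'.update y' v') :=
  CEnv.RelOn.update_fresh_right (fun x hx => (CEnv.update_of_notMem hy hx).symm ▸ h x hx) hy'

theorem CSem.var_eq {x : String} {ξ : CEnv} {v : CVal} (h : CSem (.var x) ξ v) : v = ξ x := by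
  cases h; rfl

theorem CSem.var_update_nat {x : String} {ξ : CEnv} {q n : ℕ}
    (h : CSem (.var x) (ξ.update x ⟨.nat, q⟩) ⟨.nat, n⟩) : n = q := by
  have := h.var_eq
  simp only [CEnv.update] at this
  exact eq_of_heq (Sigma.mk.inj this).2

/-- If the scrutinees of two `pfold`s agree, and their branches map related environments to
related values, then the `pfold`s have related values. -/
theorem CSem.pfold_rel {s t : CExp} {p ps w : String}
    (ihs : ∀ {ξ ξ' v v'}, CEnv.RelOn s.fv ξ ξ' → CSem s ξ v → CSem s ξ' v' → v.Rel v')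
    (iht : ∀ {ξ ξ' v v'}, CEnv.RelOn t.fv ξ ξ' → CSem t ξ v → CSem t ξ' v' → v.Rel v')
    (n : ℕ) {r r' : CExp} {ξ ξ' : CEnv} {v v' : CVal}
    (hr : ∀ m : ℕ, CSem r ξ ⟨.nat, m⟩ → m = n) (hr' : ∀ m : ℕ, CSem r' ξ' ⟨.nat, m⟩ → m = n)
    (hξ : CEnv.RelOn (s.fv ++ t.fv.removeAll [p, ps, w]) ξ ξ')
    (h : CSem (.pfold r s p ps w t) ξ v) (h' : CSem (.pfold r' s p ps w t) ξ' v') :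
    v.Rel v' := by
  have hξs : CEnv.RelOn s.fv ξ ξ' := hξ.mono (by simp)
  induction n generalizing r r' ξ ξ' v v' with
  | zero =>
    cases h with
    | pfoldSucc _ h₀ => exact absurd (hr _ h₀) (Nat.succ_ne_zero _)
    | pfoldZero _ hs =>
      cases h' with
      | pfoldSucc _ h₀ => exact absurd (hr' _ h₀) (Nat.succ_ne_zero _)
      | pfoldZero _ hs' => exact ihs hξs hs hs'
  | succ n ih =>
    cases h with
    | pfoldZero h₀ => exact absurd (hr _ h₀) (Nat.succ_ne_zero _).symm
    | @pfoldSucc _ _ _ _ _ _ _ y q _ _ _ _ _ _ _ hy h₀ hrec hs ht =>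
      cases h' with
      | pfoldZero h₀ => exact absurd (hr' _ h₀) (Nat.succ_ne_zero _).symm
      | @pfoldSucc _ _ _ _ _ _ _ y' q' _ _ _ _ _ _ _ hy' h₀' hrec' hs' ht' =>
        obtain rfl : q = n := Nat.succ.inj (hr _ h₀)
        obtain rfl : q' = q := Nat.succ.inj (hr' _ h₀')
        have hz : CEnv.RelOn (s.fv ++ t.fv.removeAll [p, ps, w])
            (ξ.update y ⟨.nat, q'⟩) (ξ'.update y' ⟨.nat, q'⟩) :=
          hξ.update_fresh (by simp_all [CExp.fv]) (by simp_all [CExp.fv])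
        have hR := ih (fun _ => CSem.var_update_nat) (fun _ => CSem.var_update_nat) hz hrec hrec'
          (hz.mono (by simp))
        have hS := ihs hξs hs hs'
        have hξt : CEnv.RelOn (((t.fv.removeAll [w]).removeAll [ps]).removeAll [p]) ξ ξ' :=
          hξ.mono (by intro x; simp +contextual [List.removeAll])
        have hT := iht (((hξt.update (.refl _)).update (.refl _)).update (.one_pair hR.2)) ht ht'
        exact ⟨congrArg₂ (fun a b : ℕ => 2 + a + b) hR.1 hT.1, FTy.Rel.max hS.2 hT.2⟩

/-- Evaluation maps related environments to related values. -/
theorem CSem.rel {e : CExp} {ξ ξ' : CEnv} {v v' : CVal} (hξ : CEnv.RelOn e.fv ξ ξ')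
    (h : CSem e ξ v) (h' : CSem e ξ' v') : v.Rel v' := by
  induction e generalizing ξ ξ' v v' with
  | var x =>
    cases h; cases h'
    exact hξ x (by simp [CExp.fv])
  | lit n =>
    cases h; cases h'
    exact CVal.Rel.refl _
  | add r s ihr ihs =>
    cases h with | add h₁ h₂ =>
    cases h' with | add h₁' h₂' =>
    exact congrArg₂ Nat.add (ihr (hξ.mono (by simp [CExp.fv])) h₁ h₁')
      (ihs (hξ.mono (by simp [CExp.fv])) h₂ h₂')
  | cmax r s ihr ihs =>
    cases h with | cmax h₁ h₂ =>
    cases h' with | cmax h₁' h₂' =>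
    exact FTy.Rel.max (ihr (hξ.mono (by simp [CExp.fv])) h₁ h₁')
      (ihs (hξ.mono (by simp [CExp.fv])) h₂ h₂')
  | pair r s ihr ihs =>
    cases h with | pair h₁ h₂ =>
    cases h' with | pair h₁' h₂' =>
    exact ⟨ihr (hξ.mono (by simp [CExp.fv])) h₁ h₁', ihs (hξ.mono (by simp [CExp.fv])) h₂ h₂'⟩
  | projc r ih =>
    cases h with | projc h =>
    cases h' with | projc h' =>
    exact (ih hξ h h').1
  | projp r ih =>
    cases h with | projp h =>
    cases h' with | projp h' =>
    exact (ih hξ h h').2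
  | lam x r ih =>
    cases h with | lam h =>
    cases h' with | lam h' =>
    exact ⟨rfl, fun a b hab => ih (CEnv.RelOn.update hξ (.one_pair hab)) (h a) (h' b)⟩
  | app r s ihr ihs =>
    cases h with | app h₁ h₂ =>
    cases h' with | app h₁' h₂' =>
    have hR := ihr (hξ.mono (by simp [CExp.fv])) h₁ h₁'
    have hS := ihs (hξ.mono (by simp [CExp.fv])) h₂ h₂'
    have hF := hR.2 _ _ hS.2
    refine ⟨?_, hF.2⟩
    have e₁ : _ = _ := hR.1
    have e₂ : _ = _ := hS.1
    have e₃ : _ = _ := hF.1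
    exact congrArg₂ Nat.add (congrArg₂ (fun a b : ℕ => 1 + a + b) e₁ e₂) e₃
  | pcase r s p ps t ihr ihs iht =>
    have hξr : CEnv.RelOn r.fv ξ ξ' := hξ.mono (by simp [CExp.fv])
    have hξs : CEnv.RelOn s.fv ξ ξ' := hξ.mono (by intro x; simp +contextual [CExp.fv])
    cases h with
    | pcaseZero h₀ hs =>
      cases h' with
      | pcaseZero _ hs' => exact ihs hξs hs hs'
      | pcaseSucc h₀' => exact absurd (ihr hξr h₀ h₀') (Nat.succ_ne_zero _).symm
    | pcaseSucc h₀ hs ht =>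
      cases h' with
      | pcaseZero h₀' => exact absurd (ihr hξr h₀ h₀') (Nat.succ_ne_zero _)
      | pcaseSucc h₀' hs' ht' =>
        have hξt : CEnv.RelOn ((t.fv.removeAll [ps]).removeAll [p]) ξ ξ' :=
          hξ.mono (by intro x; simp +contextual [CExp.fv, List.removeAll])
        exact FTy.Rel.max (ihs hξs hs hs') (iht ((hξt.update (.refl _)).update
          (.nat (Nat.succ.inj (ihr hξr h₀ h₀')))) ht ht')
  | pfold r s p ps w t ihr ihs iht =>
    have hξr : CEnv.RelOn r.fv ξ ξ' := hξ.mono (by simp [CExp.fv])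
    have hrr : ∀ {m m' : ℕ}, CSem r ξ ⟨.nat, m⟩ → CSem r ξ' ⟨.nat, m'⟩ → m = m' :=
      fun h h' => ihr hξr h h'
    obtain ⟨n, hn⟩ : ∃ n : ℕ, CSem r ξ ⟨.nat, n⟩ := by
      cases h with
      | pfoldZero h₀ => exact ⟨_, h₀⟩
      | pfoldSucc _ h₀ => exact ⟨_, h₀⟩
    obtain ⟨n', hn'⟩ : ∃ n : ℕ, CSem r ξ' ⟨.nat, n⟩ := by
      cases h' with
      | pfoldZero h₀ => exact ⟨_, h₀⟩
      | pfoldSucc _ h₀ => exact ⟨_, h₀⟩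
    refine CSem.pfold_rel ihs iht n (fun m hm => (hrr hm hn').trans (hrr hn hn').symm)
      (fun m hm => (hrr hn hm).symm) (hξ.mono ?_) h h'
    intro x
    simp +contextual [CExp.fv]

/-- Related values of product type `ℕ × γ` have equal costs. -/
theorem CVal.Rel.cost_eq {γ γ' : FTy} {c c' : ℕ} {a : γ.den} {a' : γ'.den}
    (h : CVal.Rel ⟨.prod .nat γ, (c, a)⟩ ⟨.prod .nat γ', (c', a')⟩) : c = c' := h.1

/-- The cost of a `pfold` bounds the cost of its base branch `s`, also when `s` is evaluated in
another environment related on the free variables of `s`. -/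
theorem CSem.cost_le_pfold {e : CExp} {ξ : CEnv} {v : CVal} (h : CSem e ξ v) :
    ∀ {r s t : CExp} {p ps w : String} {ξs : CEnv} {γ γ' : FTy} {sc : ℕ} {sp : γ.den}
      {vc : ℕ} {vp : γ'.den}, e = .pfold r s p ps w t → v = ⟨.prod .nat γ', (vc, vp)⟩ →
      CEnv.RelOn s.fv ξs ξ → CSem s ξs ⟨.prod .nat γ, (sc, sp)⟩ → sc ≤ vc := by
  induction h with
  | pfoldZero _ hs' =>
    intro _ _ _ _ _ _ _ _ _ _ _ _ _ he hv hξ hs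
    cases he
    subst hv
    exact (CSem.rel hξ hs hs').cost_eq.le
  | @pfoldSucc _ _ _ _ _ _ _ _ _ rc _ tc γ₀ rp _ _ hy _ _ _ _ _ ihrec =>
    intro _ _ _ _ _ _ _ _ γ' sc _ vc vp he hv hξ hs
    cases he
    have hle : sc ≤ rc :=
      ihrec rfl rfl (hξ.update_fresh_right fun hys => hy (by simp [CExp.fv, hys])) hs
    have hc : 2 + rc + tc = vc :=
      CVal.Rel.cost_eq (Eq.rec (motive := fun v _ => CVal.Rel _ v) (CVal.Rel.refl _) hv)
    omega
  | _ => intros; contradiction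

/-- **Cost monotonicity of `pfold`** (Lemma 4): for all complexity expressions
`r`, `s`, `t` and every environment `ξ*`,
`cost(⟦s⟧ξ*) ≤ cost(⟦pfold r of (s,[p,ps,w]t)⟧ξ*)`. -/
theorem cost_pfold_rec (r s t : CExp) (p ps w : String) (ξs : CEnv)
    (γ γ' : FTy) (sc : ℕ) (sp : γ.den) (vc : ℕ) (vp : γ'.den)
    (hs : CSem s ξs ⟨.prod .nat γ, (sc, sp)⟩)
    (hfold : CSem (.pfold r s p ps w t) ξs ⟨.prod .nat γ', (vc, vp)⟩) :
    sc ≤ vc := by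
  exact hfold.cost_le_pfold rfl rfl (fun x _ => CVal.Rel.refl _) hs
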